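/- Let q(m) = η₂m² + η₁m + η₀ with η₂ ≥ 0, and consider the one-step recursion m' = m - δ(β₁(q(m) - p) + β₀) with δ > 0, β₁ > 0, for fixed electrical contribution p. If m ≥ 0 and 1 - δβ₁(2η₂m + η₁) ≥ 0, then m' is a non-decreasing function of m. Consequently, for two initial masses m_a ≤ m_b satisfying this condition at every step, the trajectories remain ordered: m_a,i ≤ m_b,i for all i. -/

import Mathlib

/-- A quadratic step whose slope factor is nonnegative at both endpoints preserves their order:
the difference quotient of a quadratic is the mean of the endpoint derivatives. -/
theorem quadratic_step_le (δ β₁ β₀ η₂ η₁ η₀ p : ℝ) {m₁ m₂ : ℝ} (h : m₁ ≤ m₂)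
    (h₁ : 0 ≤ 1 - δ * β₁ * (2 * η₂ * m₁ + η₁)) (h₂ : 0 ≤ 1 - δ * β₁ * (2 * η₂ * m₂ + η₁)) :
    m₁ - δ * (β₁ * (η₂ * m₁ ^ 2 + η₁ * m₁ + η₀ - p) + β₀) ≤
      m₂ - δ * (β₁ * (η₂ * m₂ ^ 2 + η₁ * m₂ + η₀ - p) + β₀) := by
  linarith [mul_nonneg (sub_nonneg.2 h) (add_nonneg h₁ h₂)]

/-- monotone comparison principle for the closed-loop mass dynamics
m' = m - δ(β₁(q(m) - p) + β₀). -/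
theorem stmt14 (δ β₁ β₀ η₂ η₁ η₀ : ℝ) (hδ : 0 < δ) (hβ₁ : 0 < β₁) (hη₂ : 0 ≤ η₂)
    (q : ℝ → ℝ) (hq : ∀ m, q m = η₂ * m ^ 2 + η₁ * m + η₀) :
    (∀ p m₁ m₂, 0 ≤ m₁ → m₁ ≤ m₂ →
      (∀ m, m₁ ≤ m → m ≤ m₂ → 0 ≤ 1 - δ * β₁ * (2 * η₂ * m + η₁)) →
      m₁ - δ * (β₁ * (q m₁ - p) + β₀) ≤ m₂ - δ * (β₁ * (q m₂ - p) + β₀)) ∧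
    (∀ (p ma mb : ℕ → ℝ),
      (∀ i, ma (i+1) = ma i - δ * (β₁ * (q (ma i) - p i) + β₀)) →
      (∀ i, mb (i+1) = mb i - δ * (β₁ * (q (mb i) - p i) + β₀)) →
      ma 0 ≤ mb 0 →
      (∀ i, 0 ≤ ma i ∧ ∀ m, ma i ≤ m → m ≤ mb i → 0 ≤ 1 - δ * β₁ * (2 * η₂ * m + η₁)) →
      ∀ i, ma i ≤ mb i) := by
  simp only [hq]
  refine ⟨fun p m₁ m₂ _ h hm => quadratic_step_le _ _ _ _ _ _ p h (hm _ le_rfl h) (hm _ h le_rfl),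
    fun p ma mb ha hb h0 hm i => ?_⟩
  induction i with
  | zero => exact h0
  | succ i ih =>
    rw [ha, hb]
    exact quadratic_step_le _ _ _ _ _ _ _ ih ((hm i).2 _ le_rfl ih) ((hm i).2 _ ih le_rfl)
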